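/- Let p ∈ [1, ∞), μ, μ̃ ∈ P_p(X), ν, ν̃ ∈ P_p(Y), π ∈ Π(μ, ν), γ = μ ⊗ K^μ ∈ Π(μ, μ̃), γ' = ν ⊗ K^ν ∈ Π(ν, ν̃), and let π̃ be the (K^μ, K^ν)-shadow of π. If π is causal, μ ⊗ K^μ is anticausal, and ν ⊗ K^ν is causal, then π̃ is causal. If moreover μ ⊗ K^μ is optimal for W_{p,ac}(μ, μ̃) and ν ⊗ K^ν is optimal for W_{p,c}(ν, ν̃), then W_p(π, π̃)^p ≤ W_{p,ac}(μ, μ̃)^p + W_{p,c}(ν, ν̃)^p. -/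

import Mathlib

open MeasureTheory ProbabilityTheory Filter Set
open scoped ENNReal NNReal Topology ProbabilityTheory

noncomputable section

namespace AOT

variable {N : ℕ}

/-- The σ-algebra on a path space generated by the `t`-th coordinate. -/
def coordσ (X : Fin N → Type*) [∀ t, MeasurableSpace (X t)] (t : Fin N) :
    MeasurableSpace (∀ s, X s) :=
  MeasurableSpace.comap (fun x => x t) inferInstance

/-- The σ-algebra generated by the coordinates (strictly) before time `t`, from a family
of coordinate σ-algebras. -/
def pastσOf {A : Type*} (m : Fin N → MeasurableSpace A) (t : ℕ) : MeasurableSpace A :=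
  ⨆ s : Fin N, ⨆ _ : (s : ℕ) < t, m s

/-- The σ-algebra on a path space generated by the coordinates before time `t`. -/
def pastσ (X : Fin N → Type*) [∀ t, MeasurableSpace (X t)] (t : ℕ) :
    MeasurableSpace (∀ s, X s) :=
  pastσOf (coordσ X) t

/-- Conditional independence of the sub-σ-algebras `m₁` and `m₂` given `m₃`, under the
measure `π`: for all sets `A ∈ m₁`, `B ∈ m₂`, the conditional expectation (given `m₃`)
of the indicator of `A ∩ B` is a.s. the product of those of `A` and of `B`. -/
def CondIndepσ {Ω : Type*} {mΩ : MeasurableSpace Ω} (m₁ m₂ m₃ : MeasurableSpace Ω)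
    (π : @Measure Ω mΩ) : Prop :=
  ∀ A B : Set Ω, MeasurableSet[m₁] A → MeasurableSet[m₂] B →
    (π[(A ∩ B).indicator (fun _ => (1 : ℝ)) | m₃]) =ᵐ[π]
      (π[A.indicator (fun _ => (1 : ℝ)) | m₃]) * (π[B.indicator (fun _ => (1 : ℝ)) | m₃])

/-- Causality of a measure on `A × B` relative to families of coordinate σ-algebras
`mA` on `A` and `mB` on `B`: for every time `t`, the `t`-th coordinate of the first
component is conditionally independent of the (strict) past of the second component,
given the (strict) past of the first component. -/
def IsCausalFor {A B : Type*} [MeasurableSpace A] [MeasurableSpace B]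
    (mA : Fin N → MeasurableSpace A) (mB : Fin N → MeasurableSpace B)
    (π : Measure (A × B)) : Prop :=
  ∀ t : Fin N,
    CondIndepσ ((mA t).comap Prod.fst)
      ((pastσOf mB (t : ℕ)).comap Prod.snd)
      ((pastσOf mA (t : ℕ)).comap Prod.fst) π

/-- Anticausality: causality with the roles of the two components exchanged. -/
def IsAnticausalFor {A B : Type*} [MeasurableSpace A] [MeasurableSpace B]
    (mA : Fin N → MeasurableSpace A) (mB : Fin N → MeasurableSpace B)
    (π : Measure (A × B)) : Prop :=
  IsCausalFor mB mA (π.map Prod.swap)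

/-- A coupling of a measure on `X₁ × ⋯ × X_N` and a measure on `Y₁ × ⋯ × Y_N` is causal if
under it, for every `t`, `Y_{1:t}` is conditionally independent of `X_{t+1}` given `X_{1:t}`. -/
def IsCausal {X Y : Fin N → Type*} [∀ t, MeasurableSpace (X t)] [∀ t, MeasurableSpace (Y t)]
    (π : Measure ((∀ t, X t) × (∀ t, Y t))) : Prop :=
  IsCausalFor (coordσ X) (coordσ Y) π

def IsAnticausal {X Y : Fin N → Type*} [∀ t, MeasurableSpace (X t)] [∀ t, MeasurableSpace (Y t)]
    (π : Measure ((∀ t, X t) × (∀ t, Y t))) : Prop :=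
  IsAnticausalFor (coordσ X) (coordσ Y) π

def IsBicausal {X Y : Fin N → Type*} [∀ t, MeasurableSpace (X t)] [∀ t, MeasurableSpace (Y t)]
    (π : Measure ((∀ t, X t) × (∀ t, Y t))) : Prop :=
  IsCausal π ∧ IsAnticausal π

/-- `π` is a coupling of `μ` and `ν`. -/
def IsCoupling {A B : Type*} [MeasurableSpace A] [MeasurableSpace B]
    (μ : Measure A) (ν : Measure B) (π : Measure (A × B)) : Prop :=
  π.map Prod.fst = μ ∧ π.map Prod.snd = ν

/-- The four flavors of (adapted) optimal transport: plain, causal, anticausal, bicausal. -/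
inductive Flavor | plain | causal | anticausal | bicausal

/-- The adaptedness constraint corresponding to a flavor. -/
def IsAdapted {X Y : Fin N → Type*} [∀ t, MeasurableSpace (X t)] [∀ t, MeasurableSpace (Y t)] :
    Flavor → Measure ((∀ t, X t) × (∀ t, Y t)) → Prop
  | .plain => fun _ => True
  | .causal => fun π => IsCausal π
  | .anticausal => fun π => IsAnticausal π
  | .bicausal => fun π => IsBicausal π

/-- The set `Π_•(μ, ν)` of couplings of `μ` and `ν` with the adaptedness constraint
given by the flavor `b`. -/
def aCouplings {X Y : Fin N → Type*} [∀ t, MeasurableSpace (X t)] [∀ t, MeasurableSpace (Y t)]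
    (b : Flavor) (μ : Measure (∀ t, X t)) (ν : Measure (∀ t, Y t)) :
    Set (Measure ((∀ t, X t) × (∀ t, Y t))) :=
  {π | IsCoupling μ ν π ∧ IsAdapted b π}

/-- `p`-th power transport cost of a coupling. -/
def lcost (p : ℝ) {A : Type*} [MeasurableSpace A] [PseudoEMetricSpace A]
    (π : Measure (A × A)) : ℝ≥0∞ :=
  ∫⁻ z, edist z.1 z.2 ^ p ∂π

/-- The (adapted) Wasserstein distance `W_{p,•}` between two measures on a path space. -/
def W {X : Fin N → Type*} [∀ t, MeasurableSpace (X t)] [∀ t, PseudoEMetricSpace (X t)]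
    (p : ℝ) (b : Flavor) (μ ν : Measure (∀ t, X t)) : ℝ≥0∞ :=
  (⨅ π : aCouplings b μ ν, lcost p π.1) ^ (1 / p)

/-- Coordinate σ-algebras on `X × Y` viewed as a single path space with
coordinates `X_t × Y_t`. -/
def coordσ2 (X Y : Fin N → Type*) [∀ t, MeasurableSpace (X t)] [∀ t, MeasurableSpace (Y t)]
    (t : Fin N) : MeasurableSpace ((∀ s, X s) × (∀ s, Y s)) :=
  ((coordσ X t).comap Prod.fst) ⊔ ((coordσ Y t).comap Prod.snd)

/-- Adaptedness for measures on `(X × Y) × (X × Y)`, where `X × Y` is regarded as a single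
path space with `N` time steps, the `t`-th coordinate being `X_t × Y_t`. -/
def IsAdapted2 {X Y : Fin N → Type*} [∀ t, MeasurableSpace (X t)] [∀ t, MeasurableSpace (Y t)] :
    Flavor → Measure (((∀ t, X t) × (∀ t, Y t)) × ((∀ t, X t) × (∀ t, Y t))) → Prop
  | .plain => fun _ => True
  | .causal => fun θ => IsCausalFor (coordσ2 X Y) (coordσ2 X Y) θ
  | .anticausal => fun θ => IsAnticausalFor (coordσ2 X Y) (coordσ2 X Y) θ
  | .bicausal => fun θ => IsCausalFor (coordσ2 X Y) (coordσ2 X Y) θ ∧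
      IsAnticausalFor (coordσ2 X Y) (coordσ2 X Y) θ

/-- The set `Π_•(π, π̃)` of couplings of two measures on `X × Y`, with adaptedness understood
for `X × Y` as one path space. -/
def aCouplings2 {X Y : Fin N → Type*} [∀ t, MeasurableSpace (X t)] [∀ t, MeasurableSpace (Y t)]
    (b : Flavor) (π ρ : Measure ((∀ t, X t) × (∀ t, Y t))) :
    Set (Measure (((∀ t, X t) × (∀ t, Y t)) × ((∀ t, X t) × (∀ t, Y t)))) :=
  {θ | IsCoupling π ρ θ ∧ IsAdapted2 b θ}

/-- `p`-th power transport cost `∫ d_X(x,x̃)^p + d_Y(y,ỹ)^p dθ` for couplings of couplings. -/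
def lcost2 (p : ℝ) {A B : Type*} [MeasurableSpace A] [MeasurableSpace B]
    [PseudoEMetricSpace A] [PseudoEMetricSpace B]
    (θ : Measure ((A × B) × (A × B))) : ℝ≥0∞ :=
  ∫⁻ z, (edist z.1.1 z.2.1 ^ p + edist z.1.2 z.2.2 ^ p) ∂θ

/-- The (adapted) Wasserstein distance `W_{p,•}(π, π̃)` between couplings, with cost
`d_X^p + d_Y^p` and `X × Y` regarded as one path space. -/
def W2 {X Y : Fin N → Type*} [∀ t, MeasurableSpace (X t)] [∀ t, MeasurableSpace (Y t)]
    [∀ t, PseudoEMetricSpace (X t)] [∀ t, PseudoEMetricSpace (Y t)]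
    (p : ℝ) (b : Flavor) (π ρ : Measure ((∀ t, X t) × (∀ t, Y t))) : ℝ≥0∞ :=
  (⨅ θ : aCouplings2 b π ρ, lcost2 p θ.1) ^ (1 / p)

/- Relative entropy (Kullback-Leibler divergence): `D_KL(π, ρ) = ∫ log (dπ/dρ) dπ` if
`π ≪ ρ` and the integral is defined, and `∞` otherwise. -/
open Classical in
def KL {Ω : Type*} [MeasurableSpace Ω] (π ρ : Measure Ω) : ℝ≥0∞ :=
  if π ≪ ρ ∧ Integrable (llr π ρ) π then ENNReal.ofReal (∫ ω, llr π ρ ω ∂π) else ⊤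

/-- The transport value `V_•(μ, ν, c)`. -/
def V {X Y : Fin N → Type*} [∀ t, MeasurableSpace (X t)] [∀ t, MeasurableSpace (Y t)]
    (b : Flavor) (μ : Measure (∀ t, X t)) (ν : Measure (∀ t, Y t))
    (c : (∀ t, X t) × (∀ t, Y t) → ℝ) : ℝ :=
  ⨅ π : aCouplings b μ ν, ∫ z, c z ∂π.1

/-- The entropic objective `∫ c dπ + ε D_KL(π, P)`, valued in `EReal`. -/
def entObj {Ω : Type*} [MeasurableSpace Ω] (c : Ω → ℝ) (ε : ℝ) (P : Measure Ω)
    (π : Measure Ω) : EReal :=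
  ((∫ z, c z ∂π : ℝ) : EReal) + (ε : EReal) * ((KL π P : ℝ≥0∞) : EReal)

/-- The entropic transport value `E_•^ε(μ, ν, c)`, valued in `EReal`. -/
def EE {X Y : Fin N → Type*} [∀ t, MeasurableSpace (X t)] [∀ t, MeasurableSpace (Y t)]
    (b : Flavor) (μ : Measure (∀ t, X t)) (ν : Measure (∀ t, Y t))
    (c : (∀ t, X t) × (∀ t, Y t) → ℝ) (ε : ℝ) : EReal :=
  ⨅ π : aCouplings b μ ν, entObj c ε (μ.prod ν) π.1

/-- The kernel `K(x, y) := K^μ(x) ⊗ K^ν(y)` used to build the shadow. -/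
def shadowKernel {A A' B B' : Type*} [MeasurableSpace A] [MeasurableSpace A']
    [MeasurableSpace B] [MeasurableSpace B']
    (Kμ : Kernel A A') (Kν : Kernel B B') : Kernel (A × B) (A' × B') :=
  (Kμ.comap Prod.fst measurable_fst) ×ₖ (Kν.comap Prod.snd measurable_snd)

/-- The `(K^μ, K^ν)`-shadow of `π`: the second marginal of `π ⊗ (K^μ ⊗ K^ν)`. -/
def shadow {A A' B B' : Type*} [MeasurableSpace A] [MeasurableSpace A']
    [MeasurableSpace B] [MeasurableSpace B']
    (π : Measure (A × B)) (Kμ : Kernel A A') (Kν : Kernel B B') : Measure (A' × B') :=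
  (π ⊗ₘ (shadowKernel Kμ Kν)).map Prod.snd

/-- `μ` has a finite `p`-th moment. -/
def MemPp {A : Type*} [MeasurableSpace A] [PseudoEMetricSpace A] (p : ℝ) (μ : Measure A) :
    Prop :=
  ∀ x₀ : A, ∫⁻ x, edist x₀ x ^ p ∂μ ≠ ⊤

/-- `c` has growth of order at most `p`. -/
def GrowthLE {A B : Type*} [PseudoEMetricSpace A] [PseudoEMetricSpace B]
    (p : ℝ) (c : A × B → ℝ) : Prop :=
  ∃ (x₀ : A) (y₀ : B) (M : ℝ), ∀ z : A × B,
    |c z| ≤ M * (1 + (edist x₀ z.1).toReal ^ p + (edist y₀ z.2).toReal ^ p)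

/-- Weak convergence of a sequence of measures (testing against bounded continuous
functions). -/
def WeakTendsto {A : Type*} [MeasurableSpace A] [TopologicalSpace A]
    (πs : ℕ → Measure A) (π : Measure A) : Prop :=
  ∀ f : BoundedContinuousFunction A ℝ,
    Tendsto (fun n => ∫ x, f x ∂(πs n)) atTop (𝓝 (∫ x, f x ∂π))

/-- A finitely supported (discrete) measure. -/
def FinitelySupported {A : Type*} [MeasurableSpace A] (μ : Measure A) : Prop :=
  ∃ s : Finset A, μ (↑s)ᶜ = 0


/-- `K` is a version of the conditional distribution of the random element `V` given the
sub-σ-algebra `m`, under the measure `ρ`. -/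
def IsCondDistrib' {Ω E : Type*} {mΩ : MeasurableSpace Ω} [MeasurableSpace E]
    (ρ : @Measure Ω mΩ) (V : Ω → E) (m : MeasurableSpace Ω) (K : Ω → Measure E) : Prop :=
  (∀ ω, IsProbabilityMeasure (K ω)) ∧
  (∀ A : Set E, MeasurableSet A → Measurable[m] (fun ω => (K ω A).toReal)) ∧
  (∀ A : Set E, MeasurableSet A →
    (ρ[(V ⁻¹' A).indicator (fun _ => (1 : ℝ)) | m]) =ᵐ[ρ] fun ω => (K ω A).toReal)

/-- `Kμ` is a family of disintegration kernels of `μ` on a path space: `Kμ t` is a version of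
the conditional distribution of the `t`-th coordinate given the past before `t`. -/
def IsDisintegration {X : Fin N → Type*} [∀ t, MeasurableSpace (X t)]
    (μ : Measure (∀ t, X t)) (Kμ : ∀ t : Fin N, (∀ s, X s) → Measure (X t)) : Prop :=
  ∀ t : Fin N, IsCondDistrib' μ (fun x => x t) (pastσ X (t : ℕ)) (Kμ t)

variable {X Y : Fin N → Type*} [∀ t, MeasurableSpace (X t)] [∀ t, MeasurableSpace (Y t)]

open Classical in
/-- Membership in the dual building block `A_{X,μ,t}` (relative to a fixed family `Kμ` of
disintegration kernels of `μ`): for `t = 1` the bounded measurable functions of `x₁`; for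
`t ≥ 2` functions `a_t(x_{1:t}, y_{1:t-1}) - ∫ a_t(x_{1:t-1}, x̃_t, y_{1:t-1}) μ_t^{x_{1:t-1}}(dx̃_t)`
with `a_t` bounded measurable. (Here `τ` is the 0-based coordinate index, `τ = t - 1`.) -/
def MemAX (Kμ : ∀ t : Fin N, (∀ s, X s) → Measure (X t)) (τ : Fin N)
    (f : (∀ t, X t) × (∀ t, Y t) → ℝ) : Prop :=
  if (τ : ℕ) = 0 then
    ∃ a : (∀ t, X t) × (∀ t, Y t) → ℝ,
      Measurable[(coordσ X τ).comap Prod.fst] a ∧ (∃ M, ∀ ω, |a ω| ≤ M) ∧ f = a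
  else
    ∃ a : (∀ t, X t) × (∀ t, Y t) → ℝ,
      Measurable[((pastσ X (τ : ℕ) ⊔ coordσ X τ).comap Prod.fst) ⊔
        ((pastσ Y (τ : ℕ)).comap Prod.snd)] a ∧ (∃ M, ∀ ω, |a ω| ≤ M) ∧
      f = fun ω => a ω - ∫ x', a (Function.update ω.1 τ x', ω.2) ∂(Kμ τ ω.1)

open Classical in
/-- Membership in the dual building block `A_{Y,ν,t}` (symmetric to `MemAX`). -/
def MemAY (Kν : ∀ t : Fin N, (∀ s, Y s) → Measure (Y t)) (τ : Fin N)
    (f : (∀ t, X t) × (∀ t, Y t) → ℝ) : Prop :=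
  if (τ : ℕ) = 0 then
    ∃ a : (∀ t, X t) × (∀ t, Y t) → ℝ,
      Measurable[(coordσ Y τ).comap Prod.snd] a ∧ (∃ M, ∀ ω, |a ω| ≤ M) ∧ f = a
  else
    ∃ a : (∀ t, X t) × (∀ t, Y t) → ℝ,
      Measurable[((pastσ X (τ : ℕ)).comap Prod.fst) ⊔
        ((pastσ Y (τ : ℕ) ⊔ coordσ Y τ).comap Prod.snd)] a ∧ (∃ M, ∀ ω, |a ω| ≤ M) ∧
      f = fun ω => a ω - ∫ y', a (ω.1, Function.update ω.2 τ y') ∂(Kν τ ω.2)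

/-- The dual space `S_{X,μ}`: sums `∑_{t=1}^N f_t` with `f_t ∈ A_{X,μ,t}`. -/
def MemSXμ (Kμ : ∀ t : Fin N, (∀ s, X s) → Measure (X t))
    (s : (∀ t, X t) × (∀ t, Y t) → ℝ) : Prop :=
  ∃ f : Fin N → ((∀ t, X t) × (∀ t, Y t) → ℝ),
    (∀ τ, MemAX Kμ τ (f τ)) ∧ s = fun ω => ∑ τ, f τ ω

/-- The dual space `S_{Y,ν}`: sums `∑_{t=1}^N g_t` with `g_t ∈ A_{Y,ν,t}`. -/
def MemSYν (Kν : ∀ t : Fin N, (∀ s, Y s) → Measure (Y t))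
    (s : (∀ t, X t) × (∀ t, Y t) → ℝ) : Prop :=
  ∃ g : Fin N → ((∀ t, X t) × (∀ t, Y t) → ℝ),
    (∀ τ, MemAY Kν τ (g τ)) ∧ s = fun ω => ∑ τ, g τ ω

/-- The space `S_X` of bounded measurable functions depending only on `x`. -/
def MemSX (s : (∀ t, X t) × (∀ t, Y t) → ℝ) : Prop :=
  ∃ g : (∀ t, X t) → ℝ, Measurable g ∧ (∃ M, ∀ x, |g x| ≤ M) ∧ s = fun ω => g ω.1

/-- The space `S_Y` of bounded measurable functions depending only on `y`. -/
def MemSY (s : (∀ t, X t) × (∀ t, Y t) → ℝ) : Prop :=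
  ∃ g : (∀ t, Y t) → ℝ, Measurable g ∧ (∃ M, ∀ y, |g y| ≤ M) ∧ s = fun ω => g ω.2

/-- The dual space `H_•`: `H = S_X ⊕ S_Y`, `H_c = S_{X,μ} ⊕ S_Y`, `H_{ac} = S_X ⊕ S_{Y,ν}`,
`H_{bc} = S_{X,μ} ⊕ S_{Y,ν}`. -/
def MemH (Kμ : ∀ t : Fin N, (∀ s, X s) → Measure (X t))
    (Kν : ∀ t : Fin N, (∀ s, Y s) → Measure (Y t)) :
    Flavor → ((∀ t, X t) × (∀ t, Y t) → ℝ) → Prop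
  | .plain => fun h => ∃ sX sY, MemSX (X := X) (Y := Y) sX ∧ MemSY sY ∧
      h = fun ω => sX ω + sY ω
  | .causal => fun h => ∃ sX sY, MemSXμ Kμ sX ∧ MemSY sY ∧ h = fun ω => sX ω + sY ω
  | .anticausal => fun h => ∃ sX sY, MemSX (X := X) (Y := Y) sX ∧ MemSYν Kν sY ∧
      h = fun ω => sX ω + sY ω
  | .bicausal => fun h => ∃ sX sY, MemSXμ Kμ sX ∧ MemSYν Kν sY ∧ h = fun ω => sX ω + sY ω

/-- The set `Π_c(μ, ∗)` of causal measures with first marginal `μ` and arbitrary second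
marginal. -/
def causalFirst (μ : Measure (∀ t, X t)) : Set (Measure ((∀ t, X t) × (∀ t, Y t))) :=
  {π | π.map Prod.fst = μ ∧ IsCausal π}

/-- The set `Π(∗, ν)` of couplings with arbitrary first marginal and second marginal `ν`. -/
def secondMarg (ν : Measure (∀ t, Y t)) : Set (Measure ((∀ t, X t) × (∀ t, Y t))) :=
  {π | π.map Prod.snd = ν}

/-- The set `Π_{ac}(∗, ν)` of anticausal measures with second marginal `ν`. -/
def anticausalSecond (ν : Measure (∀ t, Y t)) : Set (Measure ((∀ t, X t) × (∀ t, Y t))) :=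
  {π | π.map Prod.snd = ν ∧ IsAnticausal π}

/-- The reference measure `P_c` with `dP_c/dP = exp(-c)/∫ exp(-c) dP`. -/
def Pc {Ω : Type*} [MeasurableSpace Ω] (P : Measure Ω) (c : Ω → ℝ) : Measure Ω :=
  P.withDensity
    (fun ω => ENNReal.ofReal (Real.exp (-c ω)) / ∫⁻ ω', ENNReal.ofReal (Real.exp (-c ω')) ∂P)

/-- Sinkhorn's algorithm: `full 0 = π0`; `half k` is the `D_KL`-projection of `full k`
onto `Q1`, and `full (k+1)` is the `D_KL`-projection of `half k` onto `Q2`. -/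
structure IsSinkhorn {Ω : Type*} [MeasurableSpace Ω] (Q1 Q2 : Set (Measure Ω))
    (π0 : Measure Ω) (full half : ℕ → Measure Ω) : Prop where
  init : full 0 = π0
  half_mem : ∀ k, half k ∈ Q1
  half_opt : ∀ k, ∀ ρ ∈ Q1, KL (half k) (full k) ≤ KL ρ (full k)
  full_mem : ∀ k, full (k + 1) ∈ Q2
  full_opt : ∀ k, ∀ ρ ∈ Q2, KL (full (k + 1)) (half k) ≤ KL ρ (half k)

/-- The second projection set of Sinkhorn's algorithm: `Π(∗, ν)` for the causal problem and
`Π_{ac}(∗, ν)` for the bicausal problem. -/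
def sinkQ2 (b : Flavor) (ν : Measure (∀ t, Y t)) : Set (Measure ((∀ t, X t) × (∀ t, Y t))) :=
  match b with
  | .bicausal => anticausalSecond ν
  | _ => secondMarg ν

/-- The dual class of the second Sinkhorn potential: `S_Y` for the causal problem,
`S_{Y,ν}` for the bicausal problem. -/
def MemG (Kν : ∀ t : Fin N, (∀ s, Y s) → Measure (Y t)) :
    Flavor → ((∀ t, X t) × (∀ t, Y t) → ℝ) → Prop
  | .bicausal => fun g => MemSYν Kν g
  | _ => fun g => MemSY g

/-- Real-valued entropic transport value (`ε = 1`), the infimum being taken over couplings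
with finite relative entropy. -/
def Efin (b : Flavor) (μ : Measure (∀ t, X t)) (ν : Measure (∀ t, Y t))
    (c : (∀ t, X t) × (∀ t, Y t) → ℝ) : ℝ :=
  ⨅ π : {π : Measure ((∀ t, X t) × (∀ t, Y t)) //
      π ∈ aCouplings b μ ν ∧ KL π (μ.prod ν) ≠ ⊤},
    (∫ z, c z ∂π.1 + (KL π.1 (μ.prod ν)).toReal)

section ConditionalIndependence

variable {Ω : Type*} {m₁ m₂ m₃ mΩ : MeasurableSpace Ω} {ρ : Measure Ω}
  [IsFiniteMeasure ρ]

lemma integrable_indicator_one {B : Set Ω} (hB : MeasurableSet B) :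
    Integrable (B.indicator fun _ => (1 : ℝ)) ρ :=
  (integrable_const 1).indicator hB

lemma setIntegral_inter_of_condIndepσ (hm₁ : m₁ ≤ mΩ) (hm₂ : m₂ ≤ mΩ) (hm₃ : m₃ ≤ mΩ)
    (h : CondIndepσ m₁ m₂ m₃ ρ) {A B C : Set Ω} (hA : MeasurableSet[m₁] A)
    (hB : MeasurableSet[m₂] B) (hC : MeasurableSet[m₃] C) :
    ∫ x in C ∩ A, (ρ[B.indicator (fun _ => (1 : ℝ)) | m₃]) x ∂ρ
      = ∫ x in C ∩ A, B.indicator (fun _ => (1 : ℝ)) x ∂ρ := by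
  set g := ρ[B.indicator (fun _ => (1 : ℝ)) | m₃] with hg
  have hg_int : Integrable g ρ := integrable_condExp
  have hAg : A.indicator g = A.indicator (fun _ => (1 : ℝ)) * g := by
    ext x; by_cases hx : x ∈ A <;> simp [hx]
  have hAg_int : Integrable (A.indicator g) ρ := hg_int.indicator (hm₁ _ hA)
  have hAB_int : Integrable ((A ∩ B).indicator fun _ => (1 : ℝ)) ρ :=
    integrable_indicator_one ((hm₁ _ hA).inter (hm₂ _ hB))
  have pull : ρ[A.indicator g | m₃] =ᵐ[ρ] ρ[(A ∩ B).indicator (fun _ => (1 : ℝ)) | m₃] := by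
    rw [hAg]
    exact (condExp_mul_of_stronglyMeasurable_right stronglyMeasurable_condExp (hAg ▸ hAg_int)
      (integrable_indicator_one (hm₁ _ hA))).trans (h A B hA hB).symm
  calc ∫ x in C ∩ A, g x ∂ρ = ∫ x in C, A.indicator g x ∂ρ :=
        (setIntegral_indicator (hm₁ _ hA)).symm
    _ = ∫ x in C, (ρ[A.indicator g | m₃]) x ∂ρ := (setIntegral_condExp hm₃ hAg_int hC).symm
    _ = ∫ x in C, (ρ[(A ∩ B).indicator (fun _ => (1 : ℝ)) | m₃]) x ∂ρ :=
        integral_congr_ae (ae_restrict_of_ae pull)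
    _ = ∫ x in C, (A ∩ B).indicator (fun _ => (1 : ℝ)) x ∂ρ := setIntegral_condExp hm₃ hAB_int hC
    _ = ∫ x in C ∩ A, B.indicator (fun _ => (1 : ℝ)) x ∂ρ := by
        rw [← Set.indicator_indicator, setIntegral_indicator (hm₁ _ hA)]

lemma isPiSystem_image2_inter (m m' : MeasurableSpace Ω) :
    IsPiSystem (Set.image2 (· ∩ ·) {s | MeasurableSet[m] s} {s | MeasurableSet[m'] s}) := by
  rintro _ ⟨s, hs, t, ht, rfl⟩ _ ⟨s', hs', t', ht', rfl⟩ -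
  exact ⟨s ∩ s', MeasurableSet.inter hs hs', t ∩ t', MeasurableSet.inter ht ht',
    Set.inter_inter_inter_comm _ _ _ _⟩

lemma sup_eq_generateFrom_image2_inter (m m' : MeasurableSpace Ω) :
    m ⊔ m' = MeasurableSpace.generateFrom
      (Set.image2 (· ∩ ·) {s | MeasurableSet[m] s} {s | MeasurableSet[m'] s}) := by
  apply le_antisymm
  · refine sup_le (fun s hs => ?_) (fun s hs => ?_)
    · exact MeasurableSpace.measurableSet_generateFrom
        ⟨s, hs, Set.univ, MeasurableSet.univ, Set.inter_univ s⟩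
    · exact MeasurableSpace.measurableSet_generateFrom
        ⟨Set.univ, MeasurableSet.univ, s, hs, Set.univ_inter s⟩
  · refine MeasurableSpace.generateFrom_le ?_
    rintro _ ⟨s, hs, t, ht, rfl⟩
    exact MeasurableSet.inter ((le_sup_left : m ≤ m ⊔ m') s hs)
      ((le_sup_right : m' ≤ m ⊔ m') t ht)

lemma condExp_sup_of_condIndepσ (hm₁ : m₁ ≤ mΩ) (hm₂ : m₂ ≤ mΩ) (hm₃ : m₃ ≤ mΩ)
    (h : CondIndepσ m₁ m₂ m₃ ρ) {B : Set Ω} (hB : MeasurableSet[m₂] B) :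
    ρ[B.indicator (fun _ => (1 : ℝ)) | m₃ ⊔ m₁] =ᵐ[ρ]
      ρ[B.indicator (fun _ => (1 : ℝ)) | m₃] := by
  have hsup : m₃ ⊔ m₁ ≤ mΩ := sup_le hm₃ hm₁
  have hB_int : Integrable (B.indicator fun _ => (1 : ℝ)) ρ :=
    integrable_indicator_one (hm₂ _ hB)
  have hg_int : Integrable (ρ[B.indicator (fun _ => (1 : ℝ)) | m₃]) ρ := integrable_condExp
  have hg_meas : StronglyMeasurable[m₃ ⊔ m₁] (ρ[B.indicator (fun _ => (1 : ℝ)) | m₃]) :=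
    (stronglyMeasurable_condExp (m := m₃)).mono le_sup_left
  refine (ae_eq_condExp_of_forall_setIntegral_eq hsup hB_int
    (fun s _ _ => hg_int.integrableOn) (fun s hs _ => ?_)
    hg_meas.aestronglyMeasurable).symm
  have huniv : ∫ x, (ρ[B.indicator (fun _ => (1 : ℝ)) | m₃]) x ∂ρ
      = ∫ x, B.indicator (fun _ => (1 : ℝ)) x ∂ρ := integral_condExp hm₃
  induction s, hs using MeasurableSpace.induction_on_inter
    (sup_eq_generateFrom_image2_inter m₃ m₁) (isPiSystem_image2_inter m₃ m₁) with
  | empty => simp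
  | basic t ht =>
    obtain ⟨C, hC, A, hA, rfl⟩ := ht
    exact setIntegral_inter_of_condIndepσ hm₁ hm₂ hm₃ h hA hB hC
  | compl t ht ih =>
    have e₁ := integral_add_compl (hsup t ht) hg_int
    have e₂ := integral_add_compl (hsup t ht) hB_int
    have := ih (measure_lt_top _ _)
    linarith
  | iUnion f hd hf ih =>
    rw [integral_iUnion (fun i => hsup _ (hf i)) hd hg_int.integrableOn,
      integral_iUnion (fun i => hsup _ (hf i)) hd hB_int.integrableOn]
    exact tsum_congr fun i => ih i (measure_lt_top _ _)

lemma condIndepσ_of_condExp_ae_eq {m₁ m₂ m₃ m' mΩ : MeasurableSpace Ω} {ρ : Measure Ω}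
    [IsFiniteMeasure ρ] (hm' : m' ≤ mΩ) (hm₁ : m₁ ≤ m')
    (hm₂ : m₂ ≤ mΩ) (hm₃ : m₃ ≤ m')
    (h : ∀ B, MeasurableSet[m₂] B → ∃ f : Ω → ℝ, StronglyMeasurable[m₃] f ∧
      ρ[B.indicator (fun _ => (1 : ℝ)) | m'] =ᵐ[ρ] f) :
    CondIndepσ m₁ m₂ m₃ ρ := by
  intro A B hA hB
  obtain ⟨f, hf, hBf⟩ := h B hB
  have hA' : MeasurableSet A := hm' _ (hm₁ _ hA)
  have hf_int : Integrable f ρ := integrable_condExp.congr hBf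
  have hAf : A.indicator f = A.indicator (fun _ => (1 : ℝ)) * f := by
    ext x; by_cases hx : x ∈ A <;> simp [hx]
  have hB₃ : ρ[B.indicator (fun _ => (1 : ℝ)) | m₃] =ᵐ[ρ] f :=
    calc ρ[B.indicator (fun _ => (1 : ℝ)) | m₃]
      _ =ᵐ[ρ] ρ[ρ[B.indicator (fun _ => (1 : ℝ)) | m'] | m₃] :=
          (condExp_condExp_of_le hm₃ hm').symm
      _ =ᵐ[ρ] ρ[f | m₃] := condExp_congr_ae hBf
      _ = f := condExp_of_stronglyMeasurable (hm₃.trans hm') hf hf_int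
  have hAB : ρ[(A ∩ B).indicator (fun _ => (1 : ℝ)) | m'] =ᵐ[ρ] A.indicator f := by
    rw [← Set.indicator_indicator]
    refine (condExp_indicator (integrable_indicator_one (hm₂ _ hB)) (hm₁ _ hA)).trans ?_
    filter_upwards [hBf] with x hx
    by_cases hxA : x ∈ A <;> simp [hxA, hx]
  calc ρ[(A ∩ B).indicator (fun _ => (1 : ℝ)) | m₃]
    _ =ᵐ[ρ] ρ[ρ[(A ∩ B).indicator (fun _ => (1 : ℝ)) | m'] | m₃] :=
        (condExp_condExp_of_le hm₃ hm').symm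
    _ =ᵐ[ρ] ρ[A.indicator f | m₃] := condExp_congr_ae hAB
    _ =ᵐ[ρ] ρ[A.indicator (fun _ => (1 : ℝ)) | m₃] * f := by
        rw [hAf]
        exact condExp_mul_of_stronglyMeasurable_right hf (hAf ▸ hf_int.indicator hA')
          (integrable_indicator_one hA')
    _ =ᵐ[ρ] _ := EventuallyEq.rfl.mul hB₃.symm

end ConditionalIndependence

section AdaptedKernel

variable {A B C : Type*} {mA : MeasurableSpace A} {mB : MeasurableSpace B}
  {mC : MeasurableSpace C} {MA : MeasurableSpace A} {MB : MeasurableSpace B}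
  {MC : MeasurableSpace C}

/-- The kernel `κ` maps `mB`-events to functions that are `μ`-a.e. equal to an `mA`-measurable
one. -/
def AdaptedKernel (mA : MeasurableSpace A) (mB : MeasurableSpace B)
    {MA : MeasurableSpace A} {MB : MeasurableSpace B} (μ : Measure A) (κ : Kernel A B) : Prop :=
  ∀ S, MeasurableSet[mB] S → ∃ f : A → ℝ≥0∞, Measurable[mA] f ∧ (fun a => κ a S) =ᵐ[μ] f

lemma AdaptedKernel.lintegral {μ : Measure A} {κ : Kernel A B} (h : AdaptedKernel mA mB μ κ)
    (hmB : mB ≤ MB) {g : B → ℝ≥0∞} (hg : Measurable[mB] g) :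
    ∃ f : A → ℝ≥0∞, Measurable[mA] f ∧ (fun a => ∫⁻ b, g b ∂κ a) =ᵐ[μ] f := by
  refine Measurable.ennreal_induction (mα := mB)
    (motive := fun g => ∃ f : A → ℝ≥0∞, Measurable[mA] f ∧ (fun a => ∫⁻ b, g b ∂κ a) =ᵐ[μ] f)
    (fun c s hs => ?_) (fun u v _ hu _ ihu ihv => ?_) (fun u hu hmono ih => ?_) hg
  · obtain ⟨f, hf, hκ⟩ := h s hs
    refine ⟨fun a => c * f a, hf.const_mul c, ?_⟩
    filter_upwards [hκ] with a ha
    rw [lintegral_indicator_const (hmB _ hs), ha]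
  · obtain ⟨f, hf, hκf⟩ := ihu
    obtain ⟨g, hg, hκg⟩ := ihv
    refine ⟨fun a => f a + g a, hf.add hg, ?_⟩
    filter_upwards [hκf, hκg] with a hfa hga
    rw [← hfa, ← hga]
    exact lintegral_add_left (hu.mono hmB le_rfl) _
  · choose f hf hκ using ih
    refine ⟨fun a => ⨆ n, f n a, Measurable.iSup hf, ?_⟩
    filter_upwards [ae_all_iff.2 hκ] with a ha
    rw [lintegral_iSup (fun n => (hu n).mono hmB le_rfl) hmono]
    exact iSup_congr ha

lemma AdaptedKernel.comp {μ : Measure A} {κ : Kernel A B} {η : Kernel B C}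
    (hη : AdaptedKernel mB mC (κ ∘ₘ μ) η) (hκ : AdaptedKernel mA mB μ κ)
    (hmB : mB ≤ MB) (hmC : mC ≤ MC) :
    AdaptedKernel mA mC μ (η ∘ₖ κ) := by
  intro S hS
  obtain ⟨g, hg, hηg⟩ := hη S hS
  obtain ⟨f, hf, hκf⟩ := hκ.lintegral hmB hg
  refine ⟨f, hf, ?_⟩
  filter_upwards [hκf, Measure.ae_ae_of_ae_comp hηg] with a hfa hga
  rw [← hfa, Kernel.comp_apply' _ _ _ (hmC _ hS)]
  exact lintegral_congr_ae hga

end AdaptedKernel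

lemma condExp_indicator_snd_ae_eq {A B : Type*} [MeasurableSpace A] [MeasurableSpace B]
    [StandardBorelSpace B] [Nonempty B] {μ : Measure A}
    [IsFiniteMeasure μ] {κ : Kernel A B} [IsMarkovKernel κ] {S : Set B} (hS : MeasurableSet S) :
    (μ ⊗ₘ κ)[(Prod.snd ⁻¹' S).indicator (fun _ => (1 : ℝ)) |
        MeasurableSpace.comap Prod.fst inferInstance]
      =ᵐ[μ ⊗ₘ κ] fun z => (κ z.1).real S := by
  have hfst : (μ ⊗ₘ κ).map Prod.fst = μ := Measure.fst_compProd μ κ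
  have hκ : condDistrib Prod.snd Prod.fst (μ ⊗ₘ κ) =ᵐ[(μ ⊗ₘ κ).map Prod.fst] κ := by
    refine condDistrib_ae_eq_of_measure_eq_compProd Prod.fst measurable_snd.aemeasurable ?_
    rw [hfst]
    exact Measure.map_id
  refine (condDistrib_ae_eq_condExp measurable_fst measurable_snd hS).symm.trans ?_
  filter_upwards [ae_of_ae_map measurable_fst.aemeasurable hκ] with z hz
  rw [hz]

section Filtration

variable {A B : Type*} {MA : MeasurableSpace A} {MB : MeasurableSpace B}
  {mA : Fin N → MeasurableSpace A} {mB : Fin N → MeasurableSpace B}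

lemma pastσOf_le (h : ∀ s, mA s ≤ MA) (t : ℕ) : pastσOf mA t ≤ MA :=
  iSup₂_le fun s _ => h s

lemma pastσOf_mono (mA : Fin N → MeasurableSpace A) {s t : ℕ} (hst : s ≤ t) :
    pastσOf mA s ≤ pastσOf mA t :=
  iSup₂_le fun r hr => le_iSup₂_of_le r (hr.trans_le hst) le_rfl

lemma pastσOf_succ (mA : Fin N → MeasurableSpace A) (t : Fin N) :
    pastσOf mA (t + 1) = pastσOf mA t ⊔ mA t := by
  apply le_antisymm
  · refine iSup₂_le fun s hs => ?_
    rcases Nat.lt_succ_iff_lt_or_eq.1 hs with h | h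
    · exact le_sup_of_le_left (le_iSup₂_of_le s h le_rfl)
    · rw [Fin.ext h]; exact le_sup_right
  · exact sup_le (pastσOf_mono mA t.1.le_succ) (le_iSup₂_of_le t t.1.lt_succ_self le_rfl)

lemma pastσOf_card (mA : Fin N → MeasurableSpace A) : pastσOf mA N = ⨆ s, mA s :=
  iSup_congr fun s => iSup_pos s.2

lemma IsCausalFor.condExp_eq {ρ : Measure (A × B)} [IsFiniteMeasure ρ]
    (h : IsCausalFor mA mB ρ) (hA : ∀ s, mA s ≤ MA) (hB : ∀ s, mB s ≤ MB) {t n : ℕ}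
    (htn : t ≤ n) (hn : n ≤ N) {S : Set (A × B)}
    (hS : MeasurableSet[(pastσOf mB t).comap Prod.snd] S) :
    ρ[S.indicator (fun _ => (1 : ℝ)) | (pastσOf mA n).comap Prod.fst] =ᵐ[ρ]
      ρ[S.indicator (fun _ => (1 : ℝ)) | (pastσOf mA t).comap Prod.fst] := by
  have hfst : ∀ {m : MeasurableSpace A}, m ≤ MA → m.comap (Prod.fst : A × B → A) ≤ MA.prod MB :=
    fun hm => (MeasurableSpace.comap_mono hm).trans measurable_fst.comap_le
  have hsnd : ∀ {m : MeasurableSpace B}, m ≤ MB → m.comap (Prod.snd : A × B → B) ≤ MA.prod MB :=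
    fun hm => (MeasurableSpace.comap_mono hm).trans measurable_snd.comap_le
  induction n, htn using Nat.le_induction with
  | base => exact EventuallyEq.rfl
  | succ n htn ih =>
    let s : Fin N := ⟨n, hn⟩
    refine EventuallyEq.trans ?_ (ih (Nat.le_of_succ_le hn))
    have hs : pastσOf mA (n + 1) = pastσOf mA n ⊔ mA s := pastσOf_succ mA s
    rw [hs, MeasurableSpace.comap_sup]
    exact condExp_sup_of_condIndepσ (hfst (hA s)) (hsnd (pastσOf_le hB n))
      (hfst (pastσOf_le hA n)) (h s) (MeasurableSpace.comap_mono (pastσOf_mono mB htn) _ hS)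

variable [StandardBorelSpace B] [Nonempty B] {μ : Measure A} [IsFiniteMeasure μ]
  {κ : Kernel A B} [IsMarkovKernel κ]

/-- Causality of `μ ⊗ₘ κ` means that `κ` is adapted. -/
lemma isCausalFor_compProd_iff (hA : ⨆ s, mA s = MA) (hB : ∀ s, mB s ≤ MB) :
    IsCausalFor mA mB (μ ⊗ₘ κ) ↔
      ∀ t : Fin N, AdaptedKernel (pastσOf mA t) (pastσOf mB t) μ κ := by
  have hA' : ∀ s, mA s ≤ MA := fun s => hA ▸ le_iSup mA s
  have hcard : pastσOf mA N = MA := (pastσOf_card mA).trans hA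
  constructor
  · intro h t S hS
    have h₁ := h.condExp_eq hA' hB t.2.le le_rfl ⟨S, hS, rfl⟩
    rw [hcard] at h₁
    have h₂ := condExp_indicator_snd_ae_eq (μ := μ) (κ := κ) (pastσOf_le hB t _ hS)
    obtain ⟨f, hf, hf'⟩ := StronglyMeasurable.exists_eq_measurable_comp
      (mY := pastσOf mA t) (f := (Prod.fst : A × B → A))
      (stronglyMeasurable_condExp (μ := μ ⊗ₘ κ)
        (f := (Prod.snd ⁻¹' S).indicator (fun _ => (1 : ℝ))))
    rw [hf'] at h₁
    refine ⟨fun a => ENNReal.ofReal (f a), hf.measurable.ennreal_ofReal, ?_⟩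
    filter_upwards [Measure.ae_ae_of_ae_compProd (h₂.symm.trans h₁)] with a ha
    obtain ⟨b, hb⟩ := ha.exists
    simp only [Function.comp] at hb
    rw [← hb, ofReal_measureReal]
  · intro h t
    refine condIndepσ_of_condExp_ae_eq (m' := MA.comap Prod.fst) measurable_fst.comap_le
      (MeasurableSpace.comap_mono (hA' t))
      ((MeasurableSpace.comap_mono (pastσOf_le hB t)).trans measurable_snd.comap_le)
      (MeasurableSpace.comap_mono (pastσOf_le hA' t)) ?_
    rintro _ ⟨S, hS, rfl⟩
    obtain ⟨f, hf, hκ⟩ := h t S hS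
    refine ⟨fun z => (f z.1).toReal, ?_, ?_⟩
    · have : Measurable[(pastσOf mA t).comap Prod.fst] (fun z : A × B => (f z.1).toReal) :=
        (hf.comp (comap_measurable _)).ennreal_toReal
      exact this.stronglyMeasurable
    · refine (condExp_indicator_snd_ae_eq (pastσOf_le hB t _ hS)).trans ?_
      have hκ' : ∀ᵐ a ∂(μ ⊗ₘ κ).map Prod.fst, κ a S = f a := by
        rw [show (μ ⊗ₘ κ).map Prod.fst = μ from Measure.fst_compProd μ κ]
        exact hκ
      filter_upwards [ae_of_ae_map measurable_fst.aemeasurable hκ'] with z hz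
      rw [measureReal_def, hz]

end Filtration

lemma iSup_coordσ (X : Fin N → Type*) [∀ t, MeasurableSpace (X t)] :
    ⨆ s, coordσ X s = MeasurableSpace.pi := rfl

lemma coordσ_le (X : Fin N → Type*) [∀ t, MeasurableSpace (X t)] (t : Fin N) :
    coordσ X t ≤ MeasurableSpace.pi := le_iSup (coordσ X) t

section Shadow

variable {A A' B B' : Type*} [MeasurableSpace A] [MeasurableSpace A']
  [MeasurableSpace B] [MeasurableSpace B']

instance (Kμ : Kernel A A') [IsMarkovKernel Kμ] (Kν : Kernel B B') [IsMarkovKernel Kν] :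
    IsMarkovKernel (shadowKernel Kμ Kν) := by
  unfold shadowKernel; infer_instance

lemma shadowKernel_apply (Kμ : Kernel A A') [IsMarkovKernel Kμ] (Kν : Kernel B B')
    [IsMarkovKernel Kν] (z : A × B) : shadowKernel Kμ Kν z = (Kμ z.1).prod (Kν z.2) := by
  rw [shadowKernel, Kernel.prod_apply, Kernel.comap_apply, Kernel.comap_apply]

lemma lintegral_compProd_shadowKernel_fst (π : Measure (A × B)) [SFinite π] (Kμ : Kernel A A')
    [IsMarkovKernel Kμ] (Kν : Kernel B B') [IsMarkovKernel Kν] {f : A × A' → ℝ≥0∞}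
    (hf : Measurable f) :
    ∫⁻ z, f (z.1.1, z.2.1) ∂(π ⊗ₘ shadowKernel Kμ Kν)
      = ∫⁻ z, f z ∂(π.map Prod.fst ⊗ₘ Kμ) := by
  rw [Measure.lintegral_compProd (by fun_prop), Measure.lintegral_compProd hf,
    lintegral_map hf.lintegral_kernel_prod_right' measurable_fst]
  refine lintegral_congr fun z => ?_
  rw [shadowKernel_apply, lintegral_prod _ (by fun_prop)]
  simp

lemma lintegral_compProd_shadowKernel_snd (π : Measure (A × B)) [SFinite π] (Kμ : Kernel A A')
    [IsMarkovKernel Kμ] (Kν : Kernel B B') [IsMarkovKernel Kν] {f : B × B' → ℝ≥0∞}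
    (hf : Measurable f) :
    ∫⁻ z, f (z.1.2, z.2.2) ∂(π ⊗ₘ shadowKernel Kμ Kν)
      = ∫⁻ z, f z ∂(π.map Prod.snd ⊗ₘ Kν) := by
  rw [Measure.lintegral_compProd (by fun_prop), Measure.lintegral_compProd hf,
    lintegral_map hf.lintegral_kernel_prod_right' measurable_snd]
  refine lintegral_congr fun z => ?_
  rw [shadowKernel_apply, lintegral_prod _ (by fun_prop)]
  simp

lemma lcost2_compProd_shadowKernel [PseudoEMetricSpace A] [PseudoEMetricSpace B]
    [OpensMeasurableSpace A] [OpensMeasurableSpace B] [SecondCountableTopology A]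
    [SecondCountableTopology B] (p : ℝ)
    (π : Measure (A × B)) [SFinite π] (Kμ : Kernel A A)
    [IsMarkovKernel Kμ] (Kν : Kernel B B) [IsMarkovKernel Kν] :
    lcost2 p (π ⊗ₘ shadowKernel Kμ Kν)
      = lcost p (π.map Prod.fst ⊗ₘ Kμ) + lcost p (π.map Prod.snd ⊗ₘ Kν) := by
  have hA : Measurable fun z : A × A => edist z.1 z.2 ^ p := by fun_prop
  have hB : Measurable fun z : B × B => edist z.1 z.2 ^ p := by fun_prop
  rw [lcost, lcost, ← lintegral_compProd_shadowKernel_fst π Kμ Kν hA,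
    ← lintegral_compProd_shadowKernel_snd π Kμ Kν hB]
  exact lintegral_add_left (by fun_prop) _

/-- The shadow is obtained by running backwards along `Kμ`, then along a disintegration of
`π`, and finally along `Kν`. -/
lemma shadow_compProd_eq [StandardBorelSpace A] [Nonempty A] (μ : Measure A) [IsFiniteMeasure μ]
    (κ : Kernel A B) [IsMarkovKernel κ] (Kμ : Kernel A A') [IsMarkovKernel Kμ]
    (Kν : Kernel B B') [IsMarkovKernel Kν] :
    shadow (μ ⊗ₘ κ) Kμ Kν = (Kμ ∘ₘ μ) ⊗ₘ (Kν ∘ₖ (κ ∘ₖ Kμ†μ)) := by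
  have : IsFiniteMeasure (shadow (μ ⊗ₘ κ) Kμ Kν) := by unfold shadow; infer_instance
  refine Measure.ext_prod fun {S T} hS hT => ?_
  have hg : Measurable fun a => ∫⁻ b, Kν b T ∂κ a :=
    (Kν.measurable_coe hT).lintegral_kernel
  have hmeas : Measurable fun z : A × B => Kμ z.1 S * Kν z.2 T :=
    ((Kμ.measurable_coe hS).comp measurable_fst).mul ((Kν.measurable_coe hT).comp measurable_snd)
  have hF : Measurable fun z : A' × A => S.indicator 1 z.1 * ∫⁻ b, Kν b T ∂κ z.2 :=
    ((measurable_one.indicator hS).comp measurable_fst).mul (hg.comp measurable_snd)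
  calc shadow (μ ⊗ₘ κ) Kμ Kν (S ×ˢ T)
    _ = ∫⁻ z, Kμ z.1 S * Kν z.2 T ∂(μ ⊗ₘ κ) := by
        rw [shadow, Measure.map_apply measurable_snd (hS.prod hT),
          Measure.compProd_apply (measurable_snd (hS.prod hT))]
        refine lintegral_congr fun z => ?_
        rw [shadowKernel_apply, ← Measure.prod_prod]
        rfl
    _ = ∫⁻ a, Kμ a S * ∫⁻ b, Kν b T ∂κ a ∂μ := by
        rw [Measure.lintegral_compProd hmeas]
        exact lintegral_congr fun a => lintegral_const_mul (Kμ a S) (Kν.measurable_coe hT)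
    _ = ∫⁻ z, S.indicator 1 z.2 * ∫⁻ b, Kν b T ∂κ z.1 ∂(μ ⊗ₘ Kμ) := by
        rw [Measure.lintegral_compProd
          (f := fun z : A × A' => S.indicator 1 z.2 * ∫⁻ b, Kν b T ∂κ z.1)
          (hF.comp measurable_swap)]
        refine lintegral_congr fun a => ?_
        dsimp only
        rw [lintegral_mul_const _ (measurable_one.indicator hS), lintegral_indicator_one hS]
    _ = ∫⁻ z, S.indicator 1 z.1 * ∫⁻ b, Kν b T ∂κ z.2 ∂((Kμ ∘ₘ μ) ⊗ₘ Kμ†μ) := by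
        rw [compProd_posterior_eq_map_swap, lintegral_map hF measurable_swap]
        rfl
    _ = ∫⁻ a', S.indicator 1 a' * (Kν ∘ₖ (κ ∘ₖ Kμ†μ)) a' T ∂(Kμ ∘ₘ μ) := by
        rw [Measure.lintegral_compProd hF]
        refine lintegral_congr fun a' => ?_
        dsimp only
        rw [lintegral_const_mul _ hg, Kernel.comp_apply' _ _ _ hT,
          Kernel.lintegral_comp _ _ _ (Kν.measurable_coe hT)]
    _ = ((Kμ ∘ₘ μ) ⊗ₘ (Kν ∘ₖ (κ ∘ₖ Kμ†μ))) (S ×ˢ T) := by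
        rw [Measure.compProd_apply_prod hS hT, ← lintegral_indicator hS]
        refine lintegral_congr fun a' => ?_
        by_cases ha : a' ∈ S <;> simp [ha]

end Shadow

lemma isCausal_shadow {X X' Y Y' : Fin N → Type*}
    [∀ t, MeasurableSpace (X t)] [∀ t, MeasurableSpace (X' t)]
    [∀ t, MeasurableSpace (Y t)] [∀ t, MeasurableSpace (Y' t)]
    [∀ t, StandardBorelSpace (X t)] [∀ t, StandardBorelSpace (Y t)]
    [∀ t, StandardBorelSpace (Y' t)]
    [Nonempty (∀ t, X t)] [Nonempty (∀ t, Y t)] [Nonempty (∀ t, Y' t)]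
    {π : Measure ((∀ t, X t) × (∀ t, Y t))} [IsFiniteMeasure π]
    {Kμ : Kernel (∀ t, X t) (∀ t, X' t)} [IsMarkovKernel Kμ]
    {Kν : Kernel (∀ t, Y t) (∀ t, Y' t)} [IsMarkovKernel Kν]
    (hπ : IsCausal π) (hKμ : IsAnticausal (π.map Prod.fst ⊗ₘ Kμ))
    (hKν : IsCausal (π.map Prod.snd ⊗ₘ Kν)) :
    IsCausal (shadow π Kμ Kν) := by
  set μ := π.map Prod.fst
  set κ := π.condKernel
  have hπκ : μ ⊗ₘ κ = π := π.disintegrate κ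
  have hν : π.map Prod.snd = κ ∘ₘ μ := by
    rw [← Measure.snd_compProd, hπκ]; rfl
  have hμ : Kμ†μ ∘ₘ (Kμ ∘ₘ μ) = μ := by
    rw [← Measure.snd_compProd, compProd_posterior_eq_map_swap, Measure.snd_map_swap,
      Measure.fst_compProd]
  rw [hν] at hKν
  rw [IsAnticausal, IsAnticausalFor, ← compProd_posterior_eq_map_swap] at hKμ
  rw [← hπκ] at hπ
  rw [← hπκ, shadow_compProd_eq]
  refine (isCausalFor_compProd_iff (iSup_coordσ X') (coordσ_le Y')).2 fun t => ?_
  have h₁ := (isCausalFor_compProd_iff (iSup_coordσ X') (coordσ_le X)).1 hKμ t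
  have h₂ := (isCausalFor_compProd_iff (iSup_coordσ X) (coordσ_le Y)).1 hπ t
  have h₃ := (isCausalFor_compProd_iff (iSup_coordσ Y) (coordσ_le Y')).1 hKν t
  have h₁₂ : AdaptedKernel (pastσOf (coordσ X') t) (pastσOf (coordσ Y) t) (Kμ ∘ₘ μ)
      (κ ∘ₖ Kμ†μ) :=
    AdaptedKernel.comp (by rwa [hμ]) h₁ (pastσOf_le (coordσ_le X) t) (pastσOf_le (coordσ_le Y) t)
  refine AdaptedKernel.comp ?_ h₁₂ (pastσOf_le (coordσ_le Y) t) (pastσOf_le (coordσ_le Y') t)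
  rwa [← Measure.comp_assoc, hμ]

/-- If `π` is causal, `μ ⊗ K^μ` is anticausal and `ν ⊗ K^ν` is causal, then
the `(K^μ, K^ν)`-shadow `π̃` of `π` is causal; if moreover the two couplings are optimal for
`W_{p,ac}(μ, μ̃)` resp. `W_{p,c}(ν, ν̃)`, then
`W_p(π, π̃)^p ≤ W_{p,ac}(μ, μ̃)^p + W_{p,c}(ν, ν̃)^p`. -/
theorem stmt_3 {N : ℕ} (X Y : Fin N → Type*)
    [∀ t, MeasurableSpace (X t)] [∀ t, MetricSpace (X t)]
    [∀ t, PolishSpace (X t)] [∀ t, BorelSpace (X t)]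
    [∀ t, MeasurableSpace (Y t)] [∀ t, MetricSpace (Y t)]
    [∀ t, PolishSpace (Y t)] [∀ t, BorelSpace (Y t)]
    (p : ℝ) (hp : 1 ≤ p)
    (μ μ' : Measure (∀ t, X t)) (ν ν' : Measure (∀ t, Y t))
    [IsProbabilityMeasure μ] [IsProbabilityMeasure μ']
    [IsProbabilityMeasure ν] [IsProbabilityMeasure ν']
    (hμp : MemPp p μ) (hμ'p : MemPp p μ') (hνp : MemPp p ν) (hν'p : MemPp p ν')
    (Kμ : Kernel (∀ t, X t) (∀ t, X t)) [IsMarkovKernel Kμ]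
    (Kν : Kernel (∀ t, Y t) (∀ t, Y t)) [IsMarkovKernel Kν]
    (hγ : IsCoupling μ μ' (μ ⊗ₘ Kμ)) (hγ' : IsCoupling ν ν' (ν ⊗ₘ Kν))
    (π : Measure ((∀ t, X t) × (∀ t, Y t)))
    (hπ : π ∈ aCouplings .causal μ ν)
    (hKμac : IsAnticausal (μ ⊗ₘ Kμ)) (hKνc : IsCausal (ν ⊗ₘ Kν)) :
    IsCausal (shadow π Kμ Kν) ∧
      (lcost p (μ ⊗ₘ Kμ) = W p .anticausal μ μ' ^ p →
       lcost p (ν ⊗ₘ Kν) = W p .causal ν ν' ^ p →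
       W2 p .plain π (shadow π Kμ Kν) ^ p ≤
         W p .anticausal μ μ' ^ p + W p .causal ν ν' ^ p) := by
  obtain ⟨⟨hπ₁, hπ₂⟩, hπc⟩ := hπ
  have : IsProbabilityMeasure π := by
    have : IsProbabilityMeasure (π.map Prod.fst) := hπ₁ ▸ inferInstance
    exact Measure.isProbabilityMeasure_of_map Prod.fst
  have : Nonempty (∀ t, X t) := nonempty_of_isProbabilityMeasure μ
  have : Nonempty (∀ t, Y t) := nonempty_of_isProbabilityMeasure ν
  refine ⟨isCausal_shadow hπc (hπ₁ ▸ hKμac) (hπ₂ ▸ hKνc), fun hμ hν => ?_⟩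
  have hθ : π ⊗ₘ shadowKernel Kμ Kν ∈ aCouplings2 .plain π (shadow π Kμ Kν) :=
    ⟨⟨Measure.fst_compProd π _, rfl⟩, trivial⟩
  rw [← hμ, ← hν, W2, ← ENNReal.rpow_mul, one_div_mul_cancel (by positivity), ENNReal.rpow_one]
  refine (iInf_le _ ⟨_, hθ⟩).trans_eq ?_
  rw [lcost2_compProd_shadowKernel, hπ₁, hπ₂]

end AOT
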